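/- arXiv:2211.16750 — 5 statements merged into one kernel-verified Lean document; each statement's English description precedes it below -/
import Mathlib

section
/- Let 𝒳 be a finite nonempty set, fix t > 0, and let Q : ℝ → 𝒳 → 𝒳 → ℝ be continuous in its time argument. Suppose transition functions q_{t|s} : 𝒳 × 𝒳 → ℝ for 0 ≤ s ≤ t satisfy: (i) q_{t|t}(x|y) = 1 if x = y and 0 otherwise; (ii) for each fixed x, y, the map s ↦ q_{t|s}(x|y) is continuous on [0,t], differentiable on (0,t), and satisfies the Kolmogorov backward equation ∂/∂s q_{t|s}(x|y) = −∑_{w∈𝒳} Q_s(y,w) q_{t|s}(x|w); and (iii) the marginals q_u : 𝒳 → ℝ are strictly positive, continuous in u, and differentiable at t with ∂/∂u q_u(y)|_{u=t} = ∑_{z∈𝒳} q_t(z) Q_t(z,y). Define, for s < t, the reverse transition q_{s|t}(y|x) := q_s(y) q_{t|s}(x|y)/q_t(x). Then for all x ≠ y in 𝒳, lim_{s→t⁻} q_{s|t}(y|x)/(t−s) = (q_t(y)/q_t(x))·Q_t(y,x); that is, the reverse-time process has rate matrix R_t(x,y) = q_t(y) Q_t(y,x)/q_t(x). -/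
open Finset

/-- **Reverse rate matrix (Proposition 2).**
For a continuous-time Markov chain on a finite state space with rate matrices `Q_t`,
transition probabilities `q_{t|s}` satisfying the Kolmogorov backward equation, and
strictly positive differentiable marginals `q_u`, the reverse transition
`q_{s|t}(y|x) := q_s(y)·q_{t|s}(x|y)/q_t(x)` satisfies, for `x ≠ y`,
`lim_{s→t⁻} q_{s|t}(y|x)/(t−s) = (q_t(y)/q_t(x))·Q_t(y,x)`;
i.e. the reverse-time process has rate matrix `R_t(x,y) = q_t(y) Q_t(y,x)/q_t(x)`. -/
theorem reverse_rate_matrix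
    {𝒳 : Type*} [Fintype 𝒳] [DecidableEq 𝒳] [Nonempty 𝒳]
    (t : ℝ) (ht : 0 < t)
    (Q : ℝ → 𝒳 → 𝒳 → ℝ) (hQcont : ∀ y w, Continuous fun u => Q u y w)
    -- `qts s x y` denotes the transition probability q_{t|s}(x|y)
    (qts : ℝ → 𝒳 → 𝒳 → ℝ)
    -- (i) q_{t|t}(x|y) = δ_{xy}
    (hinit : ∀ x y, qts t x y = if x = y then (1 : ℝ) else 0)
    -- (ii) continuity on [0,t] and Kolmogorov backward equation on (0,t)
    (hcont : ∀ x y, ContinuousOn (fun s => qts s x y) (Set.Icc 0 t))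
    (hbackward : ∀ (x y : 𝒳) (s : ℝ), s ∈ Set.Ioo 0 t →
      HasDerivAt (fun u => qts u x y) (-∑ w : 𝒳, Q s y w * qts s x w) s)
    -- (iii) strictly positive, continuous marginals, differentiable at t with the
    -- Kolmogorov forward derivative
    (q : ℝ → 𝒳 → ℝ)
    (hqpos : ∀ u y, 0 < q u y)
    (hqcont : ∀ y, Continuous fun u => q u y)
    (hqderiv : ∀ y, HasDerivAt (fun u => q u y) (∑ z : 𝒳, q t z * Q t z y) t)
    (x y : 𝒳) (hxy : x ≠ y) :
    Filter.Tendsto (fun s => (q s y * qts s x y / q t x) / (t - s))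
      (nhdsWithin t (Set.Iio t)) (nhds (q t y / q t x * Q t y x)) := by
  have hIoo : Set.Ioo 0 t ∈ nhdsWithin t (Set.Iio t) := Ioo_mem_nhdsLT ht
  have hlim : ∀ w, Filter.Tendsto (fun s => qts s x w) (nhdsWithin t (Set.Iio t))
      (nhds (qts t x w)) := fun w =>
    ((hcont x w t ⟨ht.le, le_rfl⟩).mono Set.Ioo_subset_Icc_self).mono_left
      (nhdsWithin_le_of_mem hIoo)
  have hderiv_lim : Filter.Tendsto (deriv fun s => qts s x y) (nhdsWithin t (Set.Iio t))
      (nhds (-Q t y x)) := by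
    have h : Filter.Tendsto (fun s => -∑ w, Q s y w * qts s x w) (nhdsWithin t (Set.Iio t))
        (nhds (-∑ w, Q t y w * qts t x w)) :=
      (tendsto_finsetSum _ fun w _ =>
        ((hQcont y w).continuousWithinAt.tendsto).mul (hlim w)).neg
    simp only [hinit, mul_ite, mul_one, mul_zero, Finset.sum_ite_eq, Finset.mem_univ,
      if_true] at h
    refine h.congr' ?_
    filter_upwards [hIoo] with s hs
    exact (hbackward x y s hs).deriv.symm
  have hleft : HasDerivWithinAt (fun s => qts s x y) (-Q t y x) (Set.Iic t) t :=
    hasDerivWithinAt_Iic_of_tendsto_deriv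
      (fun s hs => (hbackward x y s hs).differentiableAt.differentiableWithinAt)
      ((hcont x y t ⟨ht.le, le_rfl⟩).mono Set.Ioo_subset_Icc_self) hIoo hderiv_lim
  have hslope := hasDerivWithinAt_iff_tendsto_slope.1 hleft
  rw [Set.Iic_sdiff_right] at hslope
  have hprod := (((hqcont y).continuousWithinAt (s := Set.Iio t) (x := t)).tendsto.div_const
    (q t x)).mul hslope.neg
  rw [neg_neg] at hprod
  refine hprod.congr' ?_
  filter_upwards with s
  rw [slope_def_field, hinit, if_neg hxy, sub_zero, ← div_neg, neg_sub]
  ring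
end

section
/- Let C be a finite nonempty set, D a natural number, and let π₁, π₂ be strictly positive probability mass functions on the configuration space of functions x : Fin D → C. For a pmf π, a dimension d, and a configuration x, define the singleton conditional π(X^d = c | x^{∖d}) := π(x[d↦c]) / ∑_{c'∈C} π(x[d↦c']), where x[d↦c] denotes x with its d-th coordinate replaced by c. Then π₁ = π₂ if and only if for every configuration x and every dimension d, π₁(X^d = x(d) | x^{∖d}) = π₂(X^d = x(d) | x^{∖d}). -/
open Finset

/-- The singleton conditional distribution
`π(X^d = c | x^{∖d}) = π(x[d↦c]) / ∑_{c'} π(x[d↦c'])`. -/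
noncomputable def singletonCond {C : Type*} [Fintype C] {D : ℕ}
    (π : (Fin D → C) → ℝ) (d : Fin D) (x : Fin D → C) (c : C) : ℝ :=
  π (Function.update x d c) / ∑ c' : C, π (Function.update x d c')

/-- A function on a finite product that is invariant under changing any single coordinate is
constant. -/
theorem eq_of_forall_update_eq {ι β : Type*} {α : ι → Type*} [Fintype ι] [DecidableEq ι]
    {f : (∀ i, α i) → β} (hf : ∀ x i a, f (Function.update x i a) = f x) (x y : ∀ i, α i) :
    f x = f y := by
  have key : ∀ s : Finset ι, f (s.piecewise x y) = f y := fun s => by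
    induction s using Finset.induction_on with
    | empty => rw [Finset.piecewise_empty]
    | insert i s _ ih => rw [Finset.piecewise_insert, hf, ih]
  simpa using key Finset.univ

/-- Agreement of a singleton conditional makes the ratio of two positive functions invariant under
changing that coordinate. -/
theorem div_update_eq_of_singletonCond_eq {C : Type*} [Fintype C] [Nonempty C] {D : ℕ}
    {π₁ π₂ : (Fin D → C) → ℝ} (hπ₁pos : ∀ x, 0 < π₁ x) (hπ₂pos : ∀ x, 0 < π₂ x) {d : Fin D}
    (h : ∀ x : Fin D → C, singletonCond π₁ d x (x d) = singletonCond π₂ d x (x d))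
    (x : Fin D → C) (c : C) :
    π₁ (Function.update x d c) / π₂ (Function.update x d c) = π₁ x / π₂ x := by
  have ratio : ∀ y : Fin D → C, π₁ y / π₂ y =
      (∑ c', π₁ (Function.update y d c')) / ∑ c', π₂ (Function.update y d c') := fun y => by
    have hS₁ : 0 < ∑ c', π₁ (Function.update y d c') :=
      Finset.sum_pos (fun _ _ => hπ₁pos _) Finset.univ_nonempty
    have hS₂ : 0 < ∑ c', π₂ (Function.update y d c') :=
      Finset.sum_pos (fun _ _ => hπ₂pos _) Finset.univ_nonempty
    have hy := h y
    rw [singletonCond, singletonCond, Function.update_eq_self, div_eq_div_iff hS₁.ne' hS₂.ne'] at hy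
    rw [div_eq_div_iff (hπ₂pos y).ne' hS₂.ne', hy, mul_comm]
  simp only [ratio, Function.update_idem]

/-- **Proposition 3.** A strictly positive joint distribution on a finite product space
`C^D` is completely determined by its singleton conditional distributions: two such
distributions are equal iff all of their singleton conditionals agree. -/
theorem eq_iff_singleton_conditionals_eq
    {C : Type*} [Fintype C] [Nonempty C] {D : ℕ}
    (π₁ π₂ : (Fin D → C) → ℝ)
    (hπ₁pos : ∀ x, 0 < π₁ x) (hπ₁sum : ∑ x, π₁ x = 1)
    (hπ₂pos : ∀ x, 0 < π₂ x) (hπ₂sum : ∑ x, π₂ x = 1) :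
    π₁ = π₂ ↔ ∀ (x : Fin D → C) (d : Fin D),
      singletonCond π₁ d x (x d) = singletonCond π₂ d x (x d) := by
  refine ⟨fun h _ _ => by rw [h], fun h => ?_⟩
  have const := eq_of_forall_update_eq (f := fun x => π₁ x / π₂ x) fun x d c =>
    div_update_eq_of_singletonCond_eq hπ₁pos hπ₂pos (fun x => h x d) x c
  funext x
  have scaled : ∀ y, π₁ y = π₁ x / π₂ x * π₂ y := fun y =>
    (div_eq_iff (hπ₂pos y).ne').1 (const y x)
  have one : π₁ x / π₂ x = 1 := by
    rw [← hπ₁sum, Finset.sum_congr rfl fun y _ => scaled y, ← Finset.mul_sum, hπ₂sum, mul_one]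
  exact (div_eq_one_iff_eq (hπ₂pos x).ne').1 one
end

section
/- Let C be a finite nonempty set, D a natural number, and π a strictly positive probability mass function on configurations x : Fin D → C. For x, y : Fin D → C and 0 ≤ d ≤ D, let z_d denote the configuration whose first d coordinates are those of x and whose remaining coordinates are those of y (so z_0 = y and z_D = x). Then π(y)/π(x) = ∏_{d=1}^{D} π(X^d = y(d) | z_d^{∖d}) / π(X^d = x(d) | z_d^{∖d}), where the d-th factor's conditioning context consists of coordinates x(1),…,x(d−1) and y(d+1),…,y(D), and where π(X^d = c | x^{∖d}) := π(x[d↦c]) / ∑_{c'∈C} π(x[d↦c']) with x[d↦c] denoting x with its d-th coordinate replaced by c. -/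
open Finset

/-- A ratio of singleton conditionals in the same context is a ratio of joint probabilities. -/
theorem singletonCond_div_singletonCond {C : Type*} [Fintype C] [Nonempty C] {D : ℕ}
    {π : (Fin D → C) → ℝ} (hπpos : ∀ x, 0 < π x) (d : Fin D) (x : Fin D → C) (a b : C) :
    singletonCond π d x a / singletonCond π d x b =
      π (Function.update x d a) / π (Function.update x d b) :=
  div_div_div_cancel_right₀
    (Finset.sum_pos (fun _ _ => hπpos _) Finset.univ_nonempty).ne' _ _

/-- The configuration taking its first `k` coordinates from `x` and the others from `y`. -/
def splice {C : Type*} {D : ℕ} (x y : Fin D → C) (k : ℕ) : Fin D → C :=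
  fun i => if (i : ℕ) < k then x i else y i

theorem splice_zero {C : Type*} {D : ℕ} (x y : Fin D → C) : splice x y 0 = y := by
  ext i
  simp [splice]

theorem splice_self {C : Type*} {D : ℕ} (x y : Fin D → C) : splice x y D = x := by
  ext i
  simp [splice]

theorem update_splice_succ_right {C : Type*} {D : ℕ} (x y : Fin D → C) (d : Fin D) :
    Function.update (splice x y (d + 1)) d (y d) = splice x y d := by
  ext i
  rcases eq_or_ne i d with rfl | h
  · simp [splice]
  · have h_iff : (i : ℕ) < d + 1 ↔ (i : ℕ) < d := by
      have := Fin.val_ne_of_ne h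
      omega
    simp [splice, Function.update_of_ne h, h_iff]

theorem update_splice_succ_left {C : Type*} {D : ℕ} (x y : Fin D → C) (d : Fin D) :
    Function.update (splice x y (d + 1)) d (x d) = splice x y (d + 1) := by
  rw [Function.update_eq_self_iff]
  simp [splice]

/-- **Telescoping identity** from the proof of Proposition 3: for a strictly positive
distribution `π` on `C^D`,
`π(y)/π(x) = ∏_{d} π(X^d = y(d) | z_d^{∖d}) / π(X^d = x(d) | z_d^{∖d})`,
where `z_d` takes its first `d` coordinates from `x` and the remaining ones from `y`
(so that the `d`-th conditioning context consists of `x(1),…,x(d−1), y(d+1),…,y(D)`). -/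
theorem prob_ratio_telescoping
    {C : Type*} [Fintype C] [Nonempty C] {D : ℕ}
    (π : (Fin D → C) → ℝ) (hπpos : ∀ x, 0 < π x) (hπsum : ∑ x, π x = 1)
    (x y : Fin D → C) :
    π y / π x = ∏ d : Fin D,
      singletonCond π d (fun i => if (i : ℕ) ≤ (d : ℕ) then x i else y i) (y d) /
      singletonCond π d (fun i => if (i : ℕ) ≤ (d : ℕ) then x i else y i) (x d) := by
  have h_context (d : Fin D) :
      (fun i : Fin D => if (i : ℕ) ≤ (d : ℕ) then x i else y i) = splice x y (d + 1) := by
    ext i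
    simp [splice]
  simp only [h_context, singletonCond_div_singletonCond hπpos, update_splice_succ_right,
    update_splice_succ_left]
  rw [Fin.prod_univ_eq_prod_range (fun k => π (splice x y k) / π (splice x y (k + 1))) D]
  have h_telescope (n : ℕ) :
      ∏ k ∈ Finset.range n, π (splice x y k) / π (splice x y (k + 1)) =
        π (splice x y 0) / π (splice x y n) := by
    induction n with
    | zero => simp [(hπpos _).ne']
    | succ n ih => rw [Finset.prod_range_succ, ih, div_mul_div_cancel₀ (hπpos _).ne']
  rw [h_telescope, splice_zero, splice_self]
end

section
/- Let C be a finite nonempty set and D a natural number. Let μ be a probability mass function on Fin D → C (the law of X₀), and for each d let k_d : C × C → ℝ be a nonnegative kernel with ∑_{c} k_d(a, c) = 1 for every a. Define the joint pmf of (X₀, X_t) by ν(x₀, x_t) = μ(x₀) ∏_{d} k_d(x₀(d), x_t(d)). Then for every d, every configuration x with ℙ(X_t^{∖d} = x^{∖d}) > 0, and every c ∈ C: ℙ(X_t^d = c | X_t^{∖d} = x^{∖d}) = ∑_{a∈C} ℙ(X₀^d = a | X_t^{∖d} = x^{∖d}) · k_d(a, c), where all conditional probabilities are ratios of the corresponding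 marginal sums of ν. -/
open Finset

/-- In a product over coordinates, updating the argument at `i` only changes the `i`-th factor. -/
theorem prod_apply_update {ι α M : Type*} [Fintype ι] [DecidableEq ι] [CommMonoid M]
    (f : ι → α → M) (x : ι → α) (i : ι) (a : α) :
    ∏ j, f j (Function.update x i a j) = f i a * ∏ j ∈ univ.erase i, f j (x j) := by
  rw [← mul_prod_erase univ _ (mem_univ i), Function.update_self]
  congr 1
  refine prod_congr rfl fun j hj => ?_
  rw [Function.update_of_ne (ne_of_mem_erase hj)]

/-- **Identity (13) of the paper.** For a forward corruption process acting independently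
on each coordinate, with joint law `ν(x₀, x_t) = μ(x₀)·∏_d k_d(x₀(d), x_t(d))`, the
singleton conditional marginal satisfies
`ℙ(X_t^d = c | X_t^{∖d} = x^{∖d}) = ∑_a ℙ(X₀^d = a | X_t^{∖d} = x^{∖d})·k_d(a,c)`,
where all conditional probabilities are ratios of the corresponding marginal sums of ν. -/
theorem conditional_marginal_mixture
    {C : Type*} [Fintype C] [DecidableEq C] [Nonempty C] {D : ℕ}
    (μ : (Fin D → C) → ℝ) (hμ0 : ∀ x, 0 ≤ μ x) (hμ1 : ∑ x, μ x = 1)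
    (k : Fin D → C → C → ℝ)
    (hk0 : ∀ d a c, 0 ≤ k d a c) (hk1 : ∀ d a, ∑ c, k d a c = 1)
    (ν : (Fin D → C) → (Fin D → C) → ℝ)
    (hν : ∀ x₀ xt, ν x₀ xt = μ x₀ * ∏ d : Fin D, k d (x₀ d) (xt d))
    (d : Fin D) (x : Fin D → C)
    -- ℙ(X_t^{∖d} = x^{∖d}) > 0
    (hpos : 0 < ∑ x₀ : Fin D → C, ∑ c' : C, ν x₀ (Function.update x d c'))
    (c : C) :
    -- ℙ(X_t^d = c | X_t^{∖d} = x^{∖d})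
    (∑ x₀ : Fin D → C, ν x₀ (Function.update x d c)) /
        (∑ x₀ : Fin D → C, ∑ c' : C, ν x₀ (Function.update x d c'))
      = ∑ a : C,
          -- ℙ(X₀^d = a | X_t^{∖d} = x^{∖d})
          ((∑ x₀ : Fin D → C,
              if x₀ d = a then ∑ c' : C, ν x₀ (Function.update x d c') else 0) /
            (∑ x₀ : Fin D → C, ∑ c' : C, ν x₀ (Function.update x d c')))
          * k d a c := by
  have hupdate (x₀ : Fin D → C) (b : C) : ν x₀ (Function.update x d b) =
      μ x₀ * (∏ j ∈ univ.erase d, k j (x₀ j) (x j)) * k d (x₀ d) b := by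
    rw [hν, prod_apply_update (fun j => k j (x₀ j))]
    ring
  have hmarginal (x₀ : Fin D → C) : ∑ b, ν x₀ (Function.update x d b) =
      μ x₀ * ∏ j ∈ univ.erase d, k j (x₀ j) (x j) := by
    simp_rw [hupdate, ← mul_sum, hk1, mul_one]
  simp_rw [div_mul_eq_mul_div]
  rw [← sum_div]
  congr 1
  simp_rw [sum_mul]
  rw [sum_comm]
  refine sum_congr rfl fun x₀ _ => ?_
  simp_rw [ite_mul, zero_mul]
  rw [sum_ite_eq, if_pos (mem_univ _), hmarginal, hupdate]
end

section
/- Let C be a finite nonempty set and D a natural number. Let μ be a probability mass function on Fin D → C (the law of X₀), and for each d let k¹_d, k²_d : C × C → ℝ be nonnegative row-stochastic kernels. Define the joint pmf of (X₀, X_s, X_t) by ν(x₀, x_s, x_t) = μ(x₀) ∏_{d} k¹_d(x₀(d), x_s(d)) · k²_d(x_s(d), x_t(d)). Fix a dimension d and a configuration x with ℙ(X_t = x) > 0 and ℙ(X_t^{∖d} = x^{∖d}) > 0. Then for every c ∈ C: ℙ(X_s^d = c | X_t = x) = N(c) / ∑_{c'∈C} N(c'), where N(c) := ∑_{a∈C}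 ℙ(X₀^d = a | X_t^{∖d} = x^{∖d}) · k¹_d(a, c) · k²_d(c, x(d)), provided ∑_{c'} N(c') > 0; here all conditional probabilities are ratios of the corresponding marginal sums of ν. -/
open Finset

/-- Summing a product of local factors over all configurations with a fixed coordinate `d`
freezes the factor at `d` and sums out the others. -/
lemma sum_ite_eval_prod {ι C R : Type*} [Fintype ι] [DecidableEq ι] [Fintype C] [DecidableEq C]
    [CommSemiring R] (f : ι → C → R) (d : ι) (c : C) :
    (∑ y : ι → C, if y d = c then ∏ e, f e (y e) else 0)
      = f d c * ∏ e ∈ univ.erase d, ∑ a, f e a := by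
  have h := Finset.prod_univ_sum (fun _ : ι => (univ : Finset C))
    (fun e a => if e = d then (if a = c then f e a else 0) else f e a)
  rw [Fintype.piFinset_univ] at h
  calc
    _ = ∑ y : ι → C, ∏ e, if e = d then (if y e = c then f e (y e) else 0) else f e (y e) := by
      refine Finset.sum_congr rfl fun y _ => ?_
      split_ifs with hy
      · refine Finset.prod_congr rfl fun e _ => ?_
        split_ifs with he hc
        · rfl
        · exact absurd (he ▸ hy) hc
        · rfl
      · exact (Finset.prod_eq_zero (mem_univ d) (by simp [hy])).symm
    _ = _ := by
      rw [← h, ← Finset.mul_prod_erase univ _ (mem_univ d)]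
      congr 1
      · simp
      · refine Finset.prod_congr rfl fun e he => ?_
        simp [Finset.ne_of_mem_erase he]

/-- Summing a product of local factors over all configurations, with coordinate `d` singled
out. -/
lemma sum_prod_eq_sum_mul_prod_erase {ι C R : Type*} [Fintype ι] [DecidableEq ι] [Fintype C]
    [CommSemiring R] (f : ι → C → R) (d : ι) :
    ∑ y : ι → C, ∏ e, f e (y e) = (∑ a, f d a) * ∏ e ∈ univ.erase d, ∑ a, f e a := by
  have h := Finset.prod_univ_sum (fun _ : ι => (univ : Finset C)) f
  rw [Fintype.piFinset_univ] at h
  rw [← h, Finset.mul_prod_erase univ (fun e => ∑ a, f e a) (mem_univ d)]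

/-- Composing two kernels and summing over all values of coordinate `d` of the endpoint removes
that coordinate, provided both kernels at `d` are normalized. -/
lemma sum_sum_update_prod {ι C R : Type*} [Fintype ι] [DecidableEq ι] [Fintype C]
    [CommSemiring R] (k1 k2 : ι → C → C → R) (d : ι) (hk1 : ∀ a, ∑ c, k1 d a c = 1)
    (hk2 : ∀ a, ∑ c, k2 d a c = 1) (x₀ x : ι → C) :
    ∑ y : ι → C, ∑ c, ∏ e, k1 e (x₀ e) (y e) * k2 e (y e) (Function.update x d c e)
      = ∏ e ∈ univ.erase d, ∑ a, k1 e (x₀ e) a * k2 e a (x e) := by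
  rw [Finset.sum_comm]
  have h (c : C) :
      ∑ y : ι → C, ∏ e, k1 e (x₀ e) (y e) * k2 e (y e) (Function.update x d c e)
        = (∑ a, k1 d (x₀ d) a * k2 d a c)
          * ∏ e ∈ univ.erase d, ∑ a, k1 e (x₀ e) a * k2 e a (x e) := by
    rw [sum_prod_eq_sum_mul_prod_erase
      (fun e a => k1 e (x₀ e) a * k2 e a (Function.update x d c e)) d, Function.update_self]
    congr 1
    refine Finset.prod_congr rfl fun e he => ?_
    rw [Function.update_of_ne (Finset.ne_of_mem_erase he)]
  simp_rw [h]
  rw [← Finset.sum_mul, Finset.sum_comm]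
  simp [← Finset.mul_sum, hk1, hk2]

/-- **Analytical reverse-sampling formula (equations (18)–(20)).** For a forward process
factorizing over dimensions through an intermediate time `s`, with joint law
`ν(x₀, x_s, x_t) = μ(x₀)·∏_d k¹_d(x₀(d), x_s(d))·k²_d(x_s(d), x_t(d))`, the true reverse
conditional satisfies `ℙ(X_s^d = c | X_t = x) = N(c)/∑_{c'} N(c')` where
`N(c) = ∑_a ℙ(X₀^d = a | X_t^{∖d} = x^{∖d})·k¹_d(a,c)·k²_d(c,x(d))`, provided the
relevant probabilities are positive; conditional probabilities are ratios of marginal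
sums of `ν`. -/
theorem analytical_reverse_sampling
    {C : Type*} [Fintype C] [DecidableEq C] [Nonempty C] {D : ℕ}
    (μ : (Fin D → C) → ℝ) (hμ0 : ∀ x, 0 ≤ μ x) (hμ1 : ∑ x, μ x = 1)
    (k1 k2 : Fin D → C → C → ℝ)
    (hk10 : ∀ d a c, 0 ≤ k1 d a c) (hk11 : ∀ d a, ∑ c, k1 d a c = 1)
    (hk20 : ∀ d a c, 0 ≤ k2 d a c) (hk21 : ∀ d a, ∑ c, k2 d a c = 1)
    (ν : (Fin D → C) → (Fin D → C) → (Fin D → C) → ℝ)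
    (hν : ∀ x₀ xs xt, ν x₀ xs xt =
      μ x₀ * ∏ d : Fin D, k1 d (x₀ d) (xs d) * k2 d (xs d) (xt d))
    (d : Fin D) (x : Fin D → C)
    -- ℙ(X_t = x) > 0
    (hpos_t : 0 < ∑ x₀ : Fin D → C, ∑ xs : Fin D → C, ν x₀ xs x)
    -- ℙ(X_t^{∖d} = x^{∖d}) > 0
    (hpos_notd : 0 < ∑ x₀ : Fin D → C, ∑ xs : Fin D → C, ∑ c' : C,
        ν x₀ xs (Function.update x d c'))
    (N : C → ℝ)
    (hN : ∀ c, N c = ∑ a : C,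
        -- ℙ(X₀^d = a | X_t^{∖d} = x^{∖d})
        ((∑ x₀ : Fin D → C, ∑ xs : Fin D → C, ∑ c' : C,
            if x₀ d = a then ν x₀ xs (Function.update x d c') else 0) /
          (∑ x₀ : Fin D → C, ∑ xs : Fin D → C, ∑ c' : C,
            ν x₀ xs (Function.update x d c')))
        * k1 d a c * k2 d c (x d))
    (hNpos : 0 < ∑ c' : C, N c')
    (c : C) :
    -- ℙ(X_s^d = c | X_t = x)
    (∑ x₀ : Fin D → C, ∑ xs : Fin D → C, if xs d = c then ν x₀ xs x else 0) /
        (∑ x₀ : Fin D → C, ∑ xs : Fin D → C, ν x₀ xs x)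
      = N c / ∑ c' : C, N c' := by
  set r : (Fin D → C) → ℝ := fun x₀ =>
    ∏ e ∈ univ.erase d, ∑ a, k1 e (x₀ e) a * k2 e a (x e) with hr
  set S : C → ℝ := fun c => ∑ x₀ : Fin D → C, ∑ xs : Fin D → C,
    if xs d = c then ν x₀ xs x else 0 with hS
  set Z : ℝ := ∑ x₀ : Fin D → C, ∑ xs : Fin D → C, ∑ c' : C,
    ν x₀ xs (Function.update x d c') with hZ
  have hSum : ∑ x₀ : Fin D → C, ∑ xs : Fin D → C, ν x₀ xs x = ∑ c', S c' := by
    symm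
    simp only [hS]
    rw [Finset.sum_comm]
    refine Finset.sum_congr rfl fun x₀ _ => ?_
    rw [Finset.sum_comm]
    simp
  have hS_eq (c : C) : S c = ∑ x₀, μ x₀ * r x₀ * k1 d (x₀ d) c * k2 d c (x d) := by
    refine Finset.sum_congr rfl fun x₀ _ => ?_
    have h := sum_ite_eval_prod (fun e a => k1 e (x₀ e) a * k2 e a (x e)) d c
    simp only [hν, ← mul_ite_zero, ← Finset.mul_sum, h, hr]
    ring
  have hMarg (a : C) : (∑ x₀ : Fin D → C, ∑ xs : Fin D → C, ∑ c' : C,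
      if x₀ d = a then ν x₀ xs (Function.update x d c') else 0)
        = ∑ x₀ : Fin D → C, if x₀ d = a then μ x₀ * r x₀ else 0 := by
    refine Finset.sum_congr rfl fun x₀ _ => ?_
    split_ifs
    · simp only [hν, ← Finset.mul_sum, sum_sum_update_prod k1 k2 d (hk11 d) (hk21 d), hr]
    · simp
  have hNS (c : C) : N c = S c / Z := by
    simp only [hN, hMarg, hS_eq, div_mul_eq_mul_div, ← Finset.sum_div, Finset.sum_mul]
    congr 1
    rw [Finset.sum_comm]
    refine Finset.sum_congr rfl fun x₀ _ => ?_
    simp [ite_mul]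
  rw [hSum]
  simp only [hNS, ← Finset.sum_div]
  exact (div_div_div_cancel_right₀ hpos_notd.ne' _ _).symm
end
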